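/- Let M be a positive integer, set L = 2M+1, and let R be an integer with 0 ≤ R ≤ M. Consider the vector X ∈ ℝ^L indexed by j ∈ {−M, …, M} with X_j = j, and let V_R ⊆ ℂ^L be the span of the Fourier vectors (e^{2πi n j / L})_{j=−M}^{M} over integers n with |n| ≤ R. Then the orthogonal projection Π onto V_R satisfies ‖X − ΠX‖² / ‖X‖² = (6/(L²−1)) · ∑_{n=R+1}^{M} 1/sin²(πn/L), where ‖·‖ is the standard Euclidean (Hermitian) norm on ℂ^L. -/

import Mathlib

open Finset Real Complex

theorem sum_Icc_neg_succ {A : Type*} [AddCommMonoid A] (f : ℤ → A) (M : ℕ) :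
    ∑ j ∈ Icc (-((M + 1 : ℕ) : ℤ)) ((M + 1 : ℕ) : ℤ), f j =
      f (M + 1) + (f (-(M + 1)) + ∑ j ∈ Icc (-(M : ℤ)) (M : ℤ), f j) := by
  have h : Icc (-((M + 1 : ℕ) : ℤ)) ((M + 1 : ℕ) : ℤ) =
      insert ((M : ℤ) + 1) (insert (-((M : ℤ) + 1)) (Icc (-(M : ℤ)) (M : ℤ))) := by
    ext j
    simp only [mem_Icc, mem_insert]
    omega
  rw [h, sum_insert, sum_insert]
  · simp only [mem_Icc]; omega
  · simp only [mem_Icc, mem_insert]; omega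

theorem sub_one_mul_sum_zpow {K : Type*} [Field K] {z : K} (hz : z ≠ 0) (M : ℕ) :
    (z - 1) * ∑ j ∈ Icc (-(M : ℤ)) (M : ℤ), z ^ j = z ^ ((M : ℤ) + 1) - z ^ (-(M : ℤ)) := by
  induction M with
  | zero => simp
  | succ M ih =>
    rw [sum_Icc_neg_succ, mul_add, mul_add, ih]
    push_cast
    have h : z ^ (-(M : ℤ)) = z * z ^ (-((M : ℤ) + 1)) := by
      rw [← zpow_one_add₀ hz]; congr 1; ring
    rw [zpow_add_one₀ hz ((M : ℤ) + 1), h]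
    ring

theorem sub_one_mul_sum_mul_zpow {K : Type*} [Field K] {z : K} (hz : z ≠ 0) (M : ℕ) :
    (z - 1) * ∑ j ∈ Icc (-(M : ℤ)) (M : ℤ), (j : K) * z ^ j =
      M * z ^ ((M : ℤ) + 1) + (M + 1) * z ^ (-(M : ℤ)) -
        ∑ j ∈ Icc (-(M : ℤ)) (M : ℤ), z ^ j := by
  induction M with
  | zero => simp
  | succ M ih =>
    rw [sum_Icc_neg_succ, sum_Icc_neg_succ, mul_add, mul_add, ih]
    push_cast
    have h : z ^ (-(M : ℤ)) = z * z ^ (-((M : ℤ) + 1)) := by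
      rw [← zpow_one_add₀ hz]; congr 1; ring
    rw [zpow_add_one₀ hz ((M : ℤ) + 1), h]
    ring

theorem zpow_add_one_eq_zpow_neg {K : Type*} [Field K] {z : K} {M : ℕ} (h0 : z ≠ 0)
    (hz : z ^ (2 * M + 1) = 1) : z ^ ((M : ℤ) + 1) = z ^ (-(M : ℤ)) := by
  have : (M : ℤ) + 1 = -(M : ℤ) + ((2 * M + 1 : ℕ) : ℤ) := by push_cast; ring
  rw [this, zpow_add₀ h0, zpow_natCast, hz, mul_one]

theorem sum_zpow_eq_zero {K : Type*} [Field K] {z : K} {M : ℕ} (hz : z ^ (2 * M + 1) = 1)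
    (hz1 : z ≠ 1) : ∑ j ∈ Icc (-(M : ℤ)) (M : ℤ), z ^ j = 0 := by
  have h0 : z ≠ 0 := by
    rintro rfl
    simp at hz
  have h := sub_one_mul_sum_zpow h0 M
  rw [zpow_add_one_eq_zpow_neg h0 hz, sub_self] at h
  exact (mul_eq_zero.mp h).resolve_left (sub_ne_zero.mpr hz1)

theorem sub_one_mul_sum_mul_zpow_of_pow_eq_one {K : Type*} [Field K] {z : K} {M : ℕ}
    (hz : z ^ (2 * M + 1) = 1) (hz1 : z ≠ 1) :
    (z - 1) * ∑ j ∈ Icc (-(M : ℤ)) (M : ℤ), (j : K) * z ^ j = (2 * M + 1) * z ^ (-(M : ℤ)) := by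
  have h0 : z ≠ 0 := by
    rintro rfl
    simp at hz
  rw [sub_one_mul_sum_mul_zpow h0, sum_zpow_eq_zero hz hz1,
    zpow_add_one_eq_zpow_neg h0 hz]
  ring

theorem sum_Icc_neg_sq (M : ℕ) :
    ∑ j ∈ Icc (-(M : ℤ)) (M : ℤ), (j : ℝ) ^ 2 = M * (M + 1) * (2 * M + 1) / 3 := by
  induction M with
  | zero => simp
  | succ M ih =>
    rw [sum_Icc_neg_succ, ih]
    push_cast
    ring

theorem sum_Icc_neg_ite_abs_le {g : ℤ → ℝ} (hg : ∀ n, g (-n) = g n) {R M : ℕ} (hRM : R ≤ M) :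
    ∑ n ∈ Icc (-(M : ℤ)) (M : ℤ), (if |n| ≤ (R : ℤ) then 0 else g n) =
      2 * ∑ n ∈ Icc (R + 1) M, g n := by
  induction M, hRM using Nat.le_induction with
  | base =>
    rw [Icc_eq_empty (a := R + 1) (by omega), sum_empty, mul_zero]
    refine sum_eq_zero fun n hn => if_pos ?_
    rwa [abs_le, ← mem_Icc]
  | succ M hM ih =>
    have h : ¬ |(M : ℤ) + 1| ≤ (R : ℤ) := by
      rw [abs_of_nonneg (by omega)]; omega
    rw [sum_Icc_neg_succ, ih, sum_Icc_succ_top (by omega), abs_neg, if_neg h, if_neg h, hg]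
    push_cast
    ring

/-- The root of unity `exp (2πin / (2M+1))`. -/
noncomputable def latticeRoot (M : ℕ) (n : ℤ) : ℂ :=
  Complex.exp (2 * Real.pi * Complex.I * n / (2 * M + 1))

theorem two_mul_add_one_ne_zero (M : ℕ) : (2 * M + 1 : ℂ) ≠ 0 := by
  exact_mod_cast Nat.succ_ne_zero (2 * M)

theorem latticeRoot_pow (M : ℕ) (n : ℤ) : latticeRoot M n ^ (2 * M + 1) = 1 := by
  rw [latticeRoot, ← Complex.exp_nat_mul, Complex.exp_eq_one_iff]
  refine ⟨n, ?_⟩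
  have := two_mul_add_one_ne_zero M
  push_cast
  field_simp

theorem latticeRoot_ne_one {M : ℕ} {n : ℤ} (h0 : n ≠ 0) (hn : |n| ≤ 2 * M) :
    latticeRoot M n ≠ 1 := by
  rw [latticeRoot, Ne, Complex.exp_eq_one_iff]
  rintro ⟨k, hk⟩
  have hL := two_mul_add_one_ne_zero M
  have hpi : (2 * Real.pi * Complex.I : ℂ) ≠ 0 := Complex.two_pi_I_ne_zero
  rw [div_eq_iff hL, mul_comm (k : ℂ), mul_assoc (2 * Real.pi * Complex.I : ℂ) k] at hk
  have hk' : n = k * (2 * M + 1) := by exact_mod_cast mul_left_cancel₀ hpi hk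
  refine h0 (Int.eq_zero_of_abs_lt_dvd (m := 2 * M + 1) ⟨k, by rw [hk']; ring⟩ (by omega))

theorem latticeRoot_sub (M : ℕ) (m n : ℤ) :
    latticeRoot M (n - m) = (starRingEnd ℂ) (latticeRoot M m) * latticeRoot M n := by
  simp only [latticeRoot]
  rw [← Complex.exp_conj, ← Complex.exp_add]
  congr 1
  simp only [map_div₀, map_mul, map_add, map_ofNat, map_natCast, map_intCast, map_one,
    Complex.conj_I, Complex.conj_ofReal]
  push_cast
  ring

theorem exp_eq_latticeRoot_zpow (M : ℕ) (n j : ℤ) :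
    Complex.exp (2 * Real.pi * Complex.I * n * (j : ℂ) / (2 * M + 1)) = latticeRoot M n ^ j := by
  rw [latticeRoot, ← Complex.exp_int_mul]
  congr 1
  ring

theorem norm_latticeRoot (M : ℕ) (n : ℤ) : ‖latticeRoot M n‖ = 1 :=
  Complex.norm_eq_one_of_pow_eq_one (latticeRoot_pow M n) (Nat.succ_ne_zero _)

theorem norm_latticeRoot_sub_one_sq (M : ℕ) (n : ℤ) :
    ‖latticeRoot M n - 1‖ ^ 2 = 4 * Real.sin (Real.pi * n / (2 * M + 1)) ^ 2 := by
  have h : latticeRoot M n =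
      Complex.exp (Complex.I * ((2 * (Real.pi * n / (2 * M + 1)) : ℝ) : ℂ)) := by
    rw [latticeRoot]
    congr 1
    push_cast
    ring
  rw [h, Complex.norm_exp_I_mul_ofReal_sub_one, mul_div_cancel_left₀ _ two_ne_zero,
    Real.norm_eq_abs, sq_abs]
  ring

theorem norm_sum_mul_latticeRoot_zpow_sq {M : ℕ} {n : ℤ} (h0 : n ≠ 0) (hn : |n| ≤ 2 * M) :
    ‖∑ j ∈ Icc (-(M : ℤ)) (M : ℤ), (j : ℂ) * latticeRoot M n ^ j‖ ^ 2 =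
      (2 * M + 1) ^ 2 / (4 * Real.sin (Real.pi * n / (2 * M + 1)) ^ 2) := by
  have hne := latticeRoot_ne_one h0 hn
  have h := congrArg (fun w : ℂ => ‖w‖ ^ 2)
    (sub_one_mul_sum_mul_zpow_of_pow_eq_one (latticeRoot_pow M n) hne)
  have hL : ‖(2 * M + 1 : ℂ)‖ = 2 * M + 1 := by
    exact_mod_cast Complex.norm_natCast (2 * M + 1)
  simp only [norm_mul, norm_zpow, norm_latticeRoot, one_zpow, mul_one, hL, mul_pow] at h
  rw [← norm_latticeRoot_sub_one_sq, eq_div_iff, mul_comm]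
  · simpa only [norm_mul, mul_pow] using h
  · exact pow_ne_zero _ (norm_ne_zero_iff.mpr (sub_ne_zero.mpr hne))

/-- The Fourier vector of frequency `n` on the lattice `{−M,…,M}`. -/
noncomputable def latticeFourier (M : ℕ) (n : ℤ) :
    EuclideanSpace ℂ {j : ℤ // j ∈ Finset.Icc (-(M : ℤ)) (M : ℤ)} :=
  WithLp.toLp 2 fun j => latticeRoot M n ^ (j : ℤ)

theorem inner_latticeFourier_toLp (M : ℕ) (n : ℤ) (f : ℤ → ℂ) :
    inner ℂ (latticeFourier M n) (WithLp.toLp 2 fun j => f j) =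
      ∑ j ∈ Icc (-(M : ℤ)) (M : ℤ), f j * latticeRoot M (-n) ^ j := by
  have h : latticeRoot M (-n) = (starRingEnd ℂ) (latticeRoot M n) := by
    have := latticeRoot_sub M n 0
    rwa [zero_sub, show latticeRoot M 0 = 1 by simp [latticeRoot], mul_one] at this
  rw [← Finset.sum_coe_sort, h]
  simp [latticeFourier, PiLp.inner_apply]

theorem inner_latticeFourier (M : ℕ) (m n : ℤ) :
    inner ℂ (latticeFourier M m) (latticeFourier M n) =
      ∑ j ∈ Icc (-(M : ℤ)) (M : ℤ), latticeRoot M (n - m) ^ j := by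
  rw [← Finset.sum_coe_sort]
  simp [latticeFourier, PiLp.inner_apply, latticeRoot_sub, mul_zpow, mul_comm]

theorem inner_latticeFourier_self (M : ℕ) (n : ℤ) :
    inner ℂ (latticeFourier M n) (latticeFourier M n) = (2 * M + 1 : ℂ) := by
  rw [inner_latticeFourier, sub_self]
  have : ((M : ℤ) + 1 + M).toNat = 2 * M + 1 := by omega
  simp [latticeRoot, this]

theorem inner_latticeFourier_of_ne {M : ℕ} {m n : ℤ} (hm : |m| ≤ M) (hn : |n| ≤ M)
    (hmn : m ≠ n) : inner ℂ (latticeFourier M m) (latticeFourier M n) = 0 := by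
  rw [inner_latticeFourier]
  refine sum_zpow_eq_zero (latticeRoot_pow _ _) (latticeRoot_ne_one (sub_ne_zero.mpr hmn.symm) ?_)
  have := abs_sub n m
  omega

/-- Parseval's identity for the Fourier vectors on `{−M,…,M}`. -/
theorem sum_norm_inner_latticeFourier_sq (M : ℕ)
    (v : EuclideanSpace ℂ {j : ℤ // j ∈ Finset.Icc (-(M : ℤ)) (M : ℤ)}) :
    ∑ n ∈ Icc (-(M : ℤ)) (M : ℤ), ‖inner ℂ (latticeFourier M n) v‖ ^ 2 =
      (2 * M + 1) * ‖v‖ ^ 2 := by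
  have hpos : (0 : ℝ) < 2 * M + 1 := by positivity
  have hsq : (√(2 * M + 1 : ℝ)) ^ 2 = 2 * M + 1 := Real.sq_sqrt hpos.le
  have hsC : ((√(2 * M + 1 : ℝ) : ℝ) : ℂ) ^ 2 = 2 * M + 1 := by exact_mod_cast hsq
  have hs0 : ((√(2 * M + 1 : ℝ) : ℝ) : ℂ) ≠ 0 := by
    exact_mod_cast (Real.sqrt_pos.mpr hpos).ne'
  let u : {j : ℤ // j ∈ Finset.Icc (-(M : ℤ)) (M : ℤ)} →
      EuclideanSpace ℂ {j : ℤ // j ∈ Finset.Icc (-(M : ℤ)) (M : ℤ)} :=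
    fun n => ((√(2 * M + 1 : ℝ) : ℝ) : ℂ)⁻¹ • latticeFourier M n
  have hu : Orthonormal ℂ u := by
    rw [orthonormal_iff_ite]
    intro m n
    simp only [u, inner_smul_left, inner_smul_right, map_inv₀, Complex.conj_ofReal]
    split_ifs with h
    · rw [h, inner_latticeFourier_self, ← hsC]
      field_simp
    · rw [inner_latticeFourier_of_ne (abs_le.mpr (mem_Icc.mp m.2)) (abs_le.mpr (mem_Icc.mp n.2))
        (fun h' => h (Subtype.ext h')), mul_zero, mul_zero]
  let b := OrthonormalBasis.mk hu
    (hu.linearIndependent.span_eq_top_of_card_eq_finrank' (by simp)).ge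
  have hb := b.sum_sq_norm_inner_right v
  rw [← hb, ← Finset.sum_coe_sort, mul_sum]
  refine sum_congr rfl fun n _ => ?_
  simp only [b, OrthonormalBasis.coe_mk, u, inner_smul_left, norm_mul, map_inv₀,
    Complex.conj_ofReal, norm_inv, mul_pow, inv_pow, Complex.norm_real, Real.norm_eq_abs, sq_abs,
    hsq]
  field_simp

/-- Exact relative squared error of approximating the linear coordinate on the lattice
`{−M,…,M}` (`L = 2M+1`) by its orthogonal projection onto the Fourier modes of frequency
at most `R`: `‖X − ΠX‖²/‖X‖² = (6/(L²−1))·∑_{n=R+1}^{M} 1/sin²(πn/L)`. -/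
theorem coordinate_projection_error (M : ℕ) (hM : 0 < M) (R : ℕ) (hRM : R ≤ M) :
    let ι := {j : ℤ // j ∈ Finset.Icc (-(M : ℤ)) (M : ℤ)}
    let X : EuclideanSpace ℂ ι := WithLp.toLp 2 (fun j : ι => ((j : ℤ) : ℂ))
    let V : Submodule ℂ (EuclideanSpace ℂ ι) :=
      Submodule.span ℂ {v : EuclideanSpace ℂ ι | ∃ n : ℤ, |n| ≤ (R : ℤ) ∧
        v = (WithLp.toLp 2 (fun j : ι => Complex.exp (2 * Real.pi * Complex.I * n * ((j : ℤ) : ℂ) /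
          (2 * M + 1))) : EuclideanSpace ℂ ι)}
    ‖X - (Submodule.orthogonalProjectionOnto V X : EuclideanSpace ℂ ι)‖ ^ 2 / ‖X‖ ^ 2 =
      (6 / ((2 * M + 1 : ℝ) ^ 2 - 1)) *
        ∑ n ∈ Finset.Icc (R + 1) M, 1 / Real.sin (Real.pi * n / (2 * M + 1)) ^ 2 := by
  intro ι X V
  have hV : V = Submodule.span ℂ {v | ∃ n : ℤ, |n| ≤ (R : ℤ) ∧ v = latticeFourier M n} := by
    simp only [V, exp_eq_latticeRoot_zpow, latticeFourier, ι]
  have hX : ‖X‖ ^ 2 = M * (M + 1) * (2 * M + 1) / 3 := by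
    rw [← sum_Icc_neg_sq, ← Finset.sum_coe_sort, EuclideanSpace.norm_sq_eq]
    simp [X, ι]
  have hproj (n : ℤ) (hn : n ∈ Icc (-(M : ℤ)) (M : ℤ)) :
      ‖inner ℂ (latticeFourier M n) (X - (V.orthogonalProjectionOnto X : EuclideanSpace ℂ ι))‖ ^ 2 =
        if |n| ≤ (R : ℤ) then 0 else
          (2 * M + 1 : ℝ) ^ 2 / (4 * Real.sin (Real.pi * n / (2 * M + 1)) ^ 2) := by
    have hnM : |n| ≤ M := abs_le.mpr (mem_Icc.mp hn)
    split_ifs with h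
    · have hmem : latticeFourier M n ∈ V := hV ▸ Submodule.subset_span ⟨n, h, rfl⟩
      have := Submodule.inner_right_of_mem_orthogonal hmem
        (V.sub_starProjection_mem_orthogonal X)
      rw [Submodule.starProjection_apply] at this
      rw [this, norm_zero, zero_pow two_ne_zero]
    · have hmem : latticeFourier M n ∈ Vᗮ := by
        rw [hV, Submodule.mem_orthogonal]
        intro v hv
        induction hv using Submodule.span_induction with
        | mem v hv =>
          obtain ⟨m, hm, rfl⟩ := hv
          refine inner_latticeFourier_of_ne (by omega) hnM ?_
          rintro rfl
          exact h hm
        | zero => exact inner_zero_left _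
        | add x y _ _ hx hy => rw [inner_add_left, hx, hy, add_zero]
        | smul c x _ hx => rw [inner_smul_left, hx, mul_zero]
      rw [inner_sub_right, Submodule.inner_left_of_mem_orthogonal (Subtype.coe_prop _) hmem,
        sub_zero, inner_latticeFourier_toLp M n (fun j => (j : ℂ)),
        norm_sum_mul_latticeRoot_zpow_sq]
      · push_cast
        rw [mul_neg, neg_div, Real.sin_neg, neg_sq]
      · rintro h0
        apply h
        simp [neg_eq_zero.mp h0]
      · rw [abs_neg]; omega
  have hpars := sum_norm_inner_latticeFourier_sq M
    (X - (V.orthogonalProjectionOnto X : EuclideanSpace ℂ ι))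
  rw [sum_congr rfl hproj, sum_Icc_neg_ite_abs_le (fun n => by
    push_cast
    rw [mul_neg, neg_div, Real.sin_neg, neg_sq]) hRM] at hpars
  have hM' : (0 : ℝ) < M := by exact_mod_cast hM
  have hL : (2 * M + 1 : ℝ) ≠ 0 := by positivity
  have hsum : ∑ n ∈ Icc (R + 1) M,
      (2 * M + 1 : ℝ) ^ 2 / (4 * Real.sin (Real.pi * ((n : ℤ) : ℝ) / (2 * M + 1)) ^ 2) =
      (2 * M + 1 : ℝ) ^ 2 / 4 *
        ∑ n ∈ Finset.Icc (R + 1) M, 1 / Real.sin (Real.pi * n / (2 * M + 1)) ^ 2 := by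
    rw [mul_sum]
    refine sum_congr rfl fun n _ => ?_
    rw [Int.cast_natCast, div_mul_div_comm, mul_one]
  rw [hsum] at hpars
  have hnorm : ‖X - (V.orthogonalProjectionOnto X : EuclideanSpace ℂ ι)‖ ^ 2 =
      (2 * M + 1 : ℝ) / 2 *
        ∑ n ∈ Finset.Icc (R + 1) M, 1 / Real.sin (Real.pi * n / (2 * M + 1)) ^ 2 := by
    apply mul_left_cancel₀ hL
    rw [← hpars]
    ring
  have hL2 : (2 * M + 1 : ℝ) ^ 2 - 1 = 4 * M * (M + 1) := by ring
  rw [hnorm, hX, hL2]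
  field_simp
  ring
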